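/- arXiv:2102.11436 — 3 statements merged into one kernel-verified Lean document; each statement's English description precedes it below -/
import Mathlib

section
/- Perturbation bound for the relaxed MBDG problem via an optimal dual measure (Remark A.2). Assume that d(a, b) = 0 if and only if a = b, for all a, b ∈ ℝ^k. Let γ ≥ 0 and let ν* be a finite nonnegative measure on E. Assume that for every f ∈ F the map e ↦ L^e(f) is measurable and ν*-integrable, and that for every f ∈ F, R(f) + ∫_E L^e(f) dν*(e) ≥ P* (ν* is an optimal dual variable and strong duality holds for the MBDG problem). Assume the feasible sets { f ∈ F : f is G-invariant } and { f ∈ F : L^e(f) ≤ γ for all e } are nonempty, and that P* and P*(γ) are real numbers. Then P* − γ·ν*(E) ≤ P*(γ) ≤ P*, and hence |P* − P*(γ)| ≤ γ·ν*(E), where ν*(E) is the total mass (L¹-norm) of ν*. -/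
open MeasureTheory

noncomputable section

/-- The risk `R(f) = ∫ ℓ(f x, y) dμ` (Bochner integral). -/
def mbdgRisk {X Y : Type*} [MeasurableSpace X] [MeasurableSpace Y] {k : ℕ}
    (μ : Measure (X × Y)) (ℓ : (Fin k → ℝ) → Y → ℝ) (f : X → Fin k → ℝ) : ℝ :=
  ∫ p, ℓ (f p.1) p.2 ∂μ

/-- The constraint functional `L^e(f) = ∫ d(f x, f (G x e)) dμ_X`, where `μ_X` is the
pushforward of `μ` under the first projection. -/
def mbdgLval {X Y E : Type*} [MeasurableSpace X] [MeasurableSpace Y] [MeasurableSpace E]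
    {k : ℕ} (G : X → E → X) (μ : Measure (X × Y))
    (d : (Fin k → ℝ) → (Fin k → ℝ) → ℝ) (f : X → Fin k → ℝ) (e : E) : ℝ :=
  ∫ x, d (f x) (f (G x e)) ∂(μ.map Prod.fst)

/-- `G`-invariance: for every `e`, `f x = f (G x e)` for `μ_X`-a.e. `x`. -/
def GInvariant {X Y E : Type*} [MeasurableSpace X] [MeasurableSpace Y] [MeasurableSpace E]
    {k : ℕ} (G : X → E → X) (μ : Measure (X × Y)) (f : X → Fin k → ℝ) : Prop :=
  ∀ e : E, ∀ᵐ x ∂(μ.map Prod.fst), f x = f (G x e)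

/-- The constraint functional of a `G`-invariant predictor vanishes if `d` vanishes on the
diagonal. -/
theorem GInvariant.mbdgLval_eq_zero {X Y E : Type*} [MeasurableSpace X] [MeasurableSpace Y]
    [MeasurableSpace E] {k : ℕ} {G : X → E → X} {μ : Measure (X × Y)}
    {d : (Fin k → ℝ) → (Fin k → ℝ) → ℝ} {f : X → Fin k → ℝ} (hf : GInvariant G μ f)
    (hd : ∀ a, d a a = 0) (e : E) : mbdgLval G μ d f e = 0 := by
  refine integral_eq_zero_of_ae ?_
  filter_upwards [hf e] with x hx
  rw [← hx, hd, Pi.zero_apply]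

/-- **Perturbation bound for the relaxed MBDG problem via an optimal dual measure
(Remark A.2).**  If `d` is definite, `ν*` is a finite nonnegative dual-optimal measure
(i.e. `R(f) + ∫_E L^e(f) dν*(e) ≥ P*` for all `f ∈ F`), the `G`-invariant and relaxed
feasible sets are nonempty, then `P* − γ·ν*(E) ≤ P*(γ) ≤ P*`, hence
`|P* − P*(γ)| ≤ γ·ν*(E)`. -/
theorem relaxed_mbdg_perturbation_bound
    {X Y E : Type*} [MeasurableSpace X] [MeasurableSpace Y] [MeasurableSpace E]
    (G : X → E → X) (hG : ∀ e : E, Measurable fun x => G x e)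
    (μ : Measure (X × Y)) [IsProbabilityMeasure μ]
    {k : ℕ} (ℓ : (Fin k → ℝ) → Y → ℝ)
    (hℓmeas : Measurable fun p : (Fin k → ℝ) × Y => ℓ p.1 p.2)
    (hℓnn : ∀ a y, 0 ≤ ℓ a y)
    (d : (Fin k → ℝ) → (Fin k → ℝ) → ℝ)
    (hdmeas : Measurable fun q : (Fin k → ℝ) × (Fin k → ℝ) => d q.1 q.2)
    (hdnn : ∀ a b, 0 ≤ d a b)
    (hd_def : ∀ a b : Fin k → ℝ, d a b = 0 ↔ a = b)
    (F : Set (X → Fin k → ℝ)) (hF : ∀ f ∈ F, Measurable f)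
    (γ : ℝ) (hγ : 0 ≤ γ)
    (ν : Measure E) [IsFiniteMeasure ν]
    (hLmeas : ∀ f ∈ F, Measurable fun e => mbdgLval G μ d f e)
    (hLint : ∀ f ∈ F, Integrable (fun e => mbdgLval G μ d f e) ν)
    (hdualopt : ∀ f ∈ F,
      sInf (mbdgRisk μ ℓ '' {g ∈ F | GInvariant G μ g})
        ≤ mbdgRisk μ ℓ f + ∫ e, mbdgLval G μ d f e ∂ν)
    (hne_inv : {f ∈ F | GInvariant G μ f}.Nonempty)
    (hne_relax : {f ∈ F | ∀ e : E, mbdgLval G μ d f e ≤ γ}.Nonempty) :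
    (sInf (mbdgRisk μ ℓ '' {g ∈ F | GInvariant G μ g}) - γ * (ν Set.univ).toReal
        ≤ sInf (mbdgRisk μ ℓ '' {f ∈ F | ∀ e : E, mbdgLval G μ d f e ≤ γ}))
    ∧ (sInf (mbdgRisk μ ℓ '' {f ∈ F | ∀ e : E, mbdgLval G μ d f e ≤ γ})
        ≤ sInf (mbdgRisk μ ℓ '' {g ∈ F | GInvariant G μ g}))
    ∧ |sInf (mbdgRisk μ ℓ '' {g ∈ F | GInvariant G μ g})
        - sInf (mbdgRisk μ ℓ '' {f ∈ F | ∀ e : E, mbdgLval G μ d f e ≤ γ})|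
        ≤ γ * (ν Set.univ).toReal := by
  have hlower : sInf (mbdgRisk μ ℓ '' {g ∈ F | GInvariant G μ g}) - γ * (ν Set.univ).toReal
      ≤ sInf (mbdgRisk μ ℓ '' {f ∈ F | ∀ e : E, mbdgLval G μ d f e ≤ γ}) := by
    refine le_csInf (hne_relax.image _) ?_
    rintro _ ⟨f, ⟨hfF, hfγ⟩, rfl⟩
    have hint : ∫ e, mbdgLval G μ d f e ∂ν ≤ γ * (ν Set.univ).toReal :=
      calc ∫ e, mbdgLval G μ d f e ∂ν ≤ ∫ _, γ ∂ν :=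
            integral_mono (hLint f hfF) (integrable_const γ) hfγ
        _ = γ * (ν Set.univ).toReal := by
            rw [integral_const, smul_eq_mul, mul_comm, Measure.real]
    linarith [hdualopt f hfF]
  have hupper : sInf (mbdgRisk μ ℓ '' {f ∈ F | ∀ e : E, mbdgLval G μ d f e ≤ γ})
      ≤ sInf (mbdgRisk μ ℓ '' {g ∈ F | GInvariant G μ g}) := by
    refine csInf_le_csInf ⟨0, ?_⟩ (hne_inv.image _) (Set.image_mono ?_)
    · rintro _ ⟨f, -, rfl⟩
      exact integral_nonneg fun p => hℓnn _ _
    · rintro f ⟨hfF, hf⟩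
      exact ⟨hfF, fun e => (hf.mbdgLval_eq_zero (fun a => (hd_def a a).2 rfl) e).trans_le hγ⟩
  refine ⟨hlower, hupper, ?_⟩
  rw [abs_of_nonneg (sub_nonneg.2 hupper)]
  linarith

end
end

section
/- Lipschitz bound for the Lagrangian (key estimate in the proof of Proposition 3). Suppose ℓ satisfies |ℓ(a, y) − ℓ(b, y)| ≤ L_ℓ ‖a − b‖_∞ for all a, b ∈ ℝ^k, y ∈ Y, and d satisfies the uniform Lipschitz-like condition: for all measurable predictors f, g, all x ∈ X and e ∈ E, |d(f(x), f(G(x, e))) − d(g(x), g(G(x, e)))| ≤ L_d ‖f(x) − g(x)‖_∞. Fix γ ∈ ℝ and a finite nonnegative measure λ on E. Let f, g be measurable predictors such that the risks R(f), R(g) are finite, x ↦ ‖f(x) − g(x)‖_∞ is μ_X-integrable, and the maps e ↦ L^e(f) and e ↦ L^e(g) are measurable, finite-valued and λ-integrable. Then |Λ(f, λ) − Λ(g, λ)| ≤ (1 + λ(E)) · max{L_ℓ, L_d} · ∫ ‖f(x) − g(x)‖_∞ dμ_X(x). -/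
open MeasureTheory

noncomputable section

/-- The Lagrangian `Λ(f, λ) = R(f) + ∫_E (L^e(f) − γ) dλ(e)`. -/
def mbdgLag {X Y E : Type*} [MeasurableSpace X] [MeasurableSpace Y] [MeasurableSpace E]
    {k : ℕ} (G : X → E → X) (μ : Measure (X × Y)) (ℓ : (Fin k → ℝ) → Y → ℝ)
    (d : (Fin k → ℝ) → (Fin k → ℝ) → ℝ) (γ : ℝ) (lam : Measure E)
    (f : X → Fin k → ℝ) : ℝ :=
  mbdgRisk μ ℓ f + ∫ e, (mbdgLval G μ d f e - γ) ∂lam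

/-- If two almost everywhere strongly measurable functions differ by at most an integrable `h`,
then their Bochner integrals differ by at most `∫ h`, even if neither function is integrable. -/
theorem abs_integral_sub_integral_le_of_abs_sub_le {α : Type*} [MeasurableSpace α] {ν : Measure α}
    {u v h : α → ℝ} (hu : AEStronglyMeasurable u ν) (hv : AEStronglyMeasurable v ν)
    (hh : Integrable h ν) (huv : ∀ x, |u x - v x| ≤ h x) :
    |(∫ x, u x ∂ν) - ∫ x, v x ∂ν| ≤ ∫ x, h x ∂ν := by
  have hsub : Integrable (fun x => u x - v x) ν :=
    hh.mono' (hu.sub hv) (Filter.Eventually.of_forall huv)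
  by_cases hui : Integrable u ν
  · have hvi : Integrable v ν := (hui.sub hsub).congr (.of_forall fun x => sub_sub_cancel (u x) (v x))
    rw [← integral_sub hui hvi]
    exact norm_integral_le_of_norm_le (f := fun x => u x - v x) hh (.of_forall huv)
  · have hvi : ¬ Integrable v ν := fun hvi =>
      hui ((hsub.add hvi).congr (.of_forall fun x => sub_add_cancel (u x) (v x)))
    rw [integral_undef hui, integral_undef hvi, sub_zero, abs_zero]
    exact integral_nonneg fun x => (abs_nonneg _).trans (huv x)

/-- **Lipschitz bound for the Lagrangian (key estimate in the proof of Proposition 3).**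
Under the Lipschitz conditions on `ℓ` and `d` and the stated integrability
assumptions, `|Λ(f, λ) − Λ(g, λ)| ≤ (1 + λ(E)) · max{L_ℓ, L_d} · ∫ ‖f − g‖_∞ dμ_X`. -/
theorem lagrangian_lipschitz
    {X Y E : Type*} [MeasurableSpace X] [MeasurableSpace Y] [MeasurableSpace E]
    (G : X → E → X) (hG : ∀ e : E, Measurable fun x => G x e)
    (μ : Measure (X × Y)) [IsProbabilityMeasure μ]
    {k : ℕ} (ℓ : (Fin k → ℝ) → Y → ℝ)
    (hℓmeas : Measurable fun p : (Fin k → ℝ) × Y => ℓ p.1 p.2)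
    (hℓnn : ∀ a y, 0 ≤ ℓ a y)
    (d : (Fin k → ℝ) → (Fin k → ℝ) → ℝ)
    (hdmeas : Measurable fun q : (Fin k → ℝ) × (Fin k → ℝ) => d q.1 q.2)
    (hdnn : ∀ a b, 0 ≤ d a b)
    (Lℓ Ld : ℝ) (hLℓ : 0 < Lℓ) (hLd : 0 < Ld)
    (hlip : ∀ (a b : Fin k → ℝ) (y : Y), |ℓ a y - ℓ b y| ≤ Lℓ * ‖a - b‖)
    (hulip : ∀ (f g : X → Fin k → ℝ), Measurable f → Measurable g →
      ∀ (x : X) (e : E),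
        |d (f x) (f (G x e)) - d (g x) (g (G x e))| ≤ Ld * ‖f x - g x‖)
    (γ : ℝ) (lam : Measure E) [IsFiniteMeasure lam]
    (f g : X → Fin k → ℝ) (hf : Measurable f) (hg : Measurable g)
    (hfR : Integrable (fun p : X × Y => ℓ (f p.1) p.2) μ)
    (hgR : Integrable (fun p : X × Y => ℓ (g p.1) p.2) μ)
    (hdiff : Integrable (fun x => ‖f x - g x‖) (μ.map Prod.fst))
    (hfLmeas : Measurable fun e => mbdgLval G μ d f e)
    (hgLmeas : Measurable fun e => mbdgLval G μ d g e)
    (hfLint : Integrable (fun e => mbdgLval G μ d f e) lam)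
    (hgLint : Integrable (fun e => mbdgLval G μ d g e) lam) :
    |mbdgLag G μ ℓ d γ lam f - mbdgLag G μ ℓ d γ lam g|
      ≤ (1 + (lam Set.univ).toReal) * max Lℓ Ld
          * ∫ x, ‖f x - g x‖ ∂(μ.map Prod.fst) := by
  set D := ∫ x, ‖f x - g x‖ ∂(μ.map Prod.fst) with hD
  have hD0 : 0 ≤ D := integral_nonneg fun x => norm_nonneg _
  have hrisk : |mbdgRisk μ ℓ f - mbdgRisk μ ℓ g| ≤ Lℓ * D := by
    have hmap : D = ∫ p, ‖f p.1 - g p.1‖ ∂μ :=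
      integral_map measurable_fst.aemeasurable hdiff.aestronglyMeasurable
    rw [hmap, ← integral_const_mul]
    exact abs_integral_sub_integral_le_of_abs_sub_le hfR.aestronglyMeasurable
      hgR.aestronglyMeasurable ((hdiff.comp_measurable measurable_fst).const_mul Lℓ)
      fun p => hlip _ _ _
  have hmeas : ∀ (φ : X → Fin k → ℝ) (e : E), Measurable φ →
      Measurable fun x => d (φ x) (φ (G x e)) := fun φ e hφ =>
    hdmeas.comp (hφ.prodMk (hφ.comp (hG e)))
  have hL : ∀ e, |mbdgLval G μ d f e - mbdgLval G μ d g e| ≤ Ld * D := fun e => by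
    rw [hD, ← integral_const_mul]
    exact abs_integral_sub_integral_le_of_abs_sub_le (hmeas f e hf).aestronglyMeasurable
      (hmeas g e hg).aestronglyMeasurable (hdiff.const_mul Ld) fun x => hulip f g hf hg x e
  have hpenalty : |(∫ e, (mbdgLval G μ d f e - γ) ∂lam) - ∫ e, (mbdgLval G μ d g e - γ) ∂lam|
      ≤ (lam Set.univ).toReal * (Ld * D) := by
    refine (abs_integral_sub_integral_le_of_abs_sub_le (h := fun _ => Ld * D)
      (hfLint.sub (integrable_const γ)).aestronglyMeasurable
      (hgLint.sub (integrable_const γ)).aestronglyMeasurable (integrable_const _)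
      fun e => ?_).trans_eq ?_
    · simpa only [Pi.sub_apply, sub_sub_sub_cancel_right] using hL e
    · rw [integral_const, smul_eq_mul, measureReal_def]
  calc |mbdgLag G μ ℓ d γ lam f - mbdgLag G μ ℓ d γ lam g|
      ≤ Lℓ * D + (lam Set.univ).toReal * (Ld * D) := by
        rw [mbdgLag, mbdgLag, add_sub_add_comm]
        exact (abs_add_le _ _).trans (add_le_add hrisk hpenalty)
    _ ≤ max Lℓ Ld * D + (lam Set.univ).toReal * (max Lℓ Ld * D) := by
        gcongr
        · exact le_max_left _ _
        · exact le_max_right _ _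
    _ = (1 + (lam Set.univ).toReal) * max Lℓ Ld * D := by ring

end
end

section
/- Parameterization gap for the MBDG dual problem (Proposition 3). Fix γ ∈ ℝ, ε > 0, and set c := max{L_ℓ, L_d}. Suppose ℓ satisfies |ℓ(a, y) − ℓ(b, y)| ≤ L_ℓ ‖a − b‖_∞ for all a, b ∈ ℝ^k, y ∈ Y, and d satisfies the uniform Lipschitz-like condition: for all measurable predictors f, g, all x ∈ X and e ∈ E, |d(f(x), f(G(x, e))) − d(g(x), g(G(x, e)))| ≤ L_d ‖f(x) − g(x)‖_∞. Let H be a nonempty set and φ : H → F an ε-parameterization of F: for every f ∈ F there exists θ ∈ H with ∫ ‖φ(θ)(x) − f(x)‖_∞ dμ_X(x) ≤ ε. Assume all R(f) are finite and all maps e ↦ L^e(f) (f ∈ F) are measurable, finite-valued and integrable against the measures below, and that P*(γ) ∈ ℝ. Assume further: (i) there exists a finite nonnegative measure λ* on E with Λ(f, λ*) ≥ P*(γ) for every f ∈ F (strong duality for the relaxed problem with dual optimum λ*); (ii) there exists f* ∈ F with L^e(f*) ≤ γ for all e ∈ E and R(f*) = P*(γ) (primal attainment); (iii) there exists a finite nonnegative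 measure λ*_pert on E such that Λ(f, λ*_pert) + c·ε·(1 + λ*_pert(E)) ≥ D*_pert for every f ∈ F, where D*_pert := sup over finite nonnegative measures λ of [ inf_{f ∈ F} Λ(f, λ) + c·ε·(1 + λ(E)) ] (λ*_pert is dual optimal for the perturbed problem, for which strong duality holds). Then P*(γ) ≤ D_ε*(γ) ≤ P*(γ) + c·ε·(1 + λ*_pert(E)), where D_ε*(γ) := sup over finite nonnegative measures λ on E of inf_{θ ∈ H} Λ(φ(θ), λ); in particular |P*(γ) − D_ε*(γ)| ≤ ε·(1 + λ*_pert(E))·max{L_ℓ, L_d}. -/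
open MeasureTheory

noncomputable section

/-- The relaxed MBDG value `P*(γ) = inf { R(f) : f ∈ F, L^e(f) ≤ γ ∀ e }`. -/
def mbdgPgamma {X Y E : Type*} [MeasurableSpace X] [MeasurableSpace Y] [MeasurableSpace E]
    {k : ℕ} (G : X → E → X) (μ : Measure (X × Y)) (ℓ : (Fin k → ℝ) → Y → ℝ)
    (d : (Fin k → ℝ) → (Fin k → ℝ) → ℝ) (F : Set (X → Fin k → ℝ)) (γ : ℝ) : ℝ :=
  sInf (mbdgRisk μ ℓ '' {f ∈ F | ∀ e : E, mbdgLval G μ d f e ≤ γ})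

/-- The parameterized dual value
`D_ε*(γ) = sup over finite nonnegative measures λ on E of inf_{θ ∈ H} Λ(φ(θ), λ)`,
taken in the extended reals. -/
def mbdgDualValue {X Y E : Type*} [MeasurableSpace X] [MeasurableSpace Y]
    [MeasurableSpace E] {k : ℕ} (G : X → E → X) (μ : Measure (X × Y))
    (ℓ : (Fin k → ℝ) → Y → ℝ) (d : (Fin k → ℝ) → (Fin k → ℝ) → ℝ) (γ : ℝ)
    {H : Type*} (φ : H → X → Fin k → ℝ) : EReal :=
  sSup {v : EReal | ∃ lam : Measure E, IsFiniteMeasure lam ∧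
    v = ⨅ θ : H, ((mbdgLag G μ ℓ d γ lam (φ θ) : ℝ) : EReal)}

/-- The perturbed dual value
`D*_pert = sup over finite nonnegative measures λ of
[ inf_{f ∈ F} Λ(f, λ) + c·ε·(1 + λ(E)) ]`, taken in the extended reals. -/
def mbdgPertDualValue {X Y E : Type*} [MeasurableSpace X] [MeasurableSpace Y]
    [MeasurableSpace E] {k : ℕ} (G : X → E → X) (μ : Measure (X × Y))
    (ℓ : (Fin k → ℝ) → Y → ℝ) (d : (Fin k → ℝ) → (Fin k → ℝ) → ℝ) (γ : ℝ)
    (F : Set (X → Fin k → ℝ)) (c ε : ℝ) : EReal :=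
  sSup {v : EReal | ∃ lam : Measure E, IsFiniteMeasure lam ∧
    v = (⨅ f : {f : X → Fin k → ℝ // f ∈ F},
          ((mbdgLag G μ ℓ d γ lam f.1 : ℝ) : EReal))
        + ((c * ε * (1 + (lam Set.univ).toReal) : ℝ) : EReal)}

/-- If two measurable functions differ by at most an integrable function, their Bochner integrals
differ by at most its integral; neither function needs to be integrable. -/
lemma abs_integral_sub_integral_le {α : Type*} [MeasurableSpace α] {ν : Measure α}
    {u v w : α → ℝ} (hu : AEStronglyMeasurable u ν) (hv : AEStronglyMeasurable v ν)
    (hw : Integrable w ν) (h : ∀ x, |u x - v x| ≤ w x) :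
    |∫ x, u x ∂ν - ∫ x, v x ∂ν| ≤ ∫ x, w x ∂ν := by
  have huv : Integrable (fun x => u x - v x) ν :=
    hw.mono' (hu.sub hv) (Filter.Eventually.of_forall h)
  by_cases hvi : Integrable v ν
  · have hui : Integrable u ν :=
      (huv.add hvi).congr (Filter.Eventually.of_forall fun x => sub_add_cancel (u x) (v x))
    rw [← integral_sub hui hvi]
    exact norm_integral_le_of_norm_le (f := fun x => u x - v x) hw (Filter.Eventually.of_forall h)
  · have hui : ¬ Integrable u ν := fun hui => hvi <|
      (hui.sub huv).congr (Filter.Eventually.of_forall fun x => sub_sub_cancel (u x) (v x))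
    rw [integral_undef hui, integral_undef hvi, sub_self, abs_zero]
    exact integral_nonneg fun x => (abs_nonneg _).trans (h x)

/-- The risk is Lipschitz in the `L¹` distance of predictors. -/
lemma abs_mbdgRisk_sub_le {X Y : Type*} [MeasurableSpace X] [MeasurableSpace Y] {k : ℕ}
    {μ : Measure (X × Y)} {ℓ : (Fin k → ℝ) → Y → ℝ} {L : ℝ}
    (hlip : ∀ a b y, |ℓ a y - ℓ b y| ≤ L * ‖a - b‖) {f g : X → Fin k → ℝ}
    (hf : Integrable (fun p : X × Y => ℓ (f p.1) p.2) μ)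
    (hg : Integrable (fun p : X × Y => ℓ (g p.1) p.2) μ)
    (hfg : Integrable (fun x => ‖f x - g x‖) (μ.map Prod.fst)) :
    |mbdgRisk μ ℓ f - mbdgRisk μ ℓ g| ≤ L * ∫ x, ‖f x - g x‖ ∂(μ.map Prod.fst) := by
  rw [integral_map measurable_fst.aemeasurable hfg.aestronglyMeasurable, ← integral_const_mul]
  exact abs_integral_sub_integral_le hf.aestronglyMeasurable hg.aestronglyMeasurable
    ((hfg.comp_measurable measurable_fst).const_mul L) fun p => hlip _ _ _

/-- The constraint functional is Lipschitz in the `L¹` distance of predictors. -/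
lemma abs_mbdgLval_sub_le {X Y E : Type*} [MeasurableSpace X] [MeasurableSpace Y]
    [MeasurableSpace E] {k : ℕ} {G : X → E → X} {μ : Measure (X × Y)}
    {d : (Fin k → ℝ) → (Fin k → ℝ) → ℝ}
    (hd : Measurable fun q : (Fin k → ℝ) × (Fin k → ℝ) => d q.1 q.2) {L : ℝ} {e : E}
    (hG : Measurable fun x => G x e) {f g : X → Fin k → ℝ} (hf : Measurable f) (hg : Measurable g)
    (hlip : ∀ x, |d (f x) (f (G x e)) - d (g x) (g (G x e))| ≤ L * ‖f x - g x‖)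
    (hfg : Integrable (fun x => ‖f x - g x‖) (μ.map Prod.fst)) :
    |mbdgLval G μ d f e - mbdgLval G μ d g e| ≤ L * ∫ x, ‖f x - g x‖ ∂(μ.map Prod.fst) := by
  rw [← integral_const_mul]
  exact abs_integral_sub_integral_le
    (hd.comp (hf.prodMk (hf.comp hG))).aestronglyMeasurable
    (hd.comp (hg.prodMk (hg.comp hG))).aestronglyMeasurable (hfg.const_mul L) hlip

/-- Pointwise bounds on the risk and the constraint values bound the Lagrangian. -/
lemma mbdgLag_le_add {X Y E : Type*} [MeasurableSpace X] [MeasurableSpace Y]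
    [MeasurableSpace E] {k : ℕ} {G : X → E → X} {μ : Measure (X × Y)} {ℓ : (Fin k → ℝ) → Y → ℝ}
    {d : (Fin k → ℝ) → (Fin k → ℝ) → ℝ} {γ b : ℝ} {lam : Measure E} [IsFiniteMeasure lam]
    {f g : X → Fin k → ℝ} (hf : Integrable (fun e => mbdgLval G μ d f e) lam)
    (hg : Integrable (fun e => mbdgLval G μ d g e) lam)
    (hR : mbdgRisk μ ℓ f ≤ mbdgRisk μ ℓ g + b)
    (hL : ∀ e, mbdgLval G μ d f e ≤ mbdgLval G μ d g e + b) :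
    mbdgLag G μ ℓ d γ lam f ≤ mbdgLag G μ ℓ d γ lam g + b * (1 + (lam Set.univ).toReal) := by
  have hg' : Integrable (fun e => mbdgLval G μ d g e - γ) lam := hg.sub (integrable_const γ)
  have key : ∫ e, (mbdgLval G μ d f e - γ) ∂lam ≤ ∫ e, ((mbdgLval G μ d g e - γ) + b) ∂lam :=
    integral_mono (hf.sub (integrable_const γ)) (hg'.add (integrable_const b))
      fun e => by dsimp only; linarith [hL e]
  rw [integral_add hg' (integrable_const b), integral_const, smul_eq_mul, measureReal_def] at key
  unfold mbdgLag
  linarith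

/-- The Lagrangian at a feasible predictor is at most its risk. -/
lemma mbdgLag_le_mbdgRisk {X Y E : Type*} [MeasurableSpace X] [MeasurableSpace Y]
    [MeasurableSpace E] {k : ℕ} {G : X → E → X} {μ : Measure (X × Y)} {ℓ : (Fin k → ℝ) → Y → ℝ}
    {d : (Fin k → ℝ) → (Fin k → ℝ) → ℝ} {γ : ℝ} (lam : Measure E) {f : X → Fin k → ℝ}
    (hf : ∀ e, mbdgLval G μ d f e ≤ γ) :
    mbdgLag G μ ℓ d γ lam f ≤ mbdgRisk μ ℓ f := by
  have := integral_nonpos (μ := lam) (f := fun e => mbdgLval G μ d f e - γ)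
    fun e => sub_nonpos.2 (hf e)
  unfold mbdgLag
  linarith

/-- **Parameterization gap for the MBDG dual problem (Proposition 3).**
Under the Lipschitz conditions on `ℓ` and `d`, an `ε`-parameterization `φ : H → F`,
strong duality for the relaxed problem (with dual optimum `λ*`), primal attainment at
`f*`, and dual optimality of `λ*_pert` for the perturbed problem, one has
`P*(γ) ≤ D_ε*(γ) ≤ P*(γ) + c·ε·(1 + λ*_pert(E))` with `c = max{L_ℓ, L_d}`; in
particular `|P*(γ) − D_ε*(γ)| ≤ ε·(1 + λ*_pert(E))·max{L_ℓ, L_d}`. -/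
theorem mbdg_parameterization_gap
    {X Y E : Type*} [MeasurableSpace X] [MeasurableSpace Y] [MeasurableSpace E]
    (G : X → E → X) (hG : ∀ e : E, Measurable fun x => G x e)
    (μ : Measure (X × Y)) [IsProbabilityMeasure μ]
    {k : ℕ} (ℓ : (Fin k → ℝ) → Y → ℝ)
    (hℓmeas : Measurable fun p : (Fin k → ℝ) × Y => ℓ p.1 p.2)
    (hℓnn : ∀ a y, 0 ≤ ℓ a y)
    (d : (Fin k → ℝ) → (Fin k → ℝ) → ℝ)
    (hdmeas : Measurable fun q : (Fin k → ℝ) × (Fin k → ℝ) => d q.1 q.2)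
    (hdnn : ∀ a b, 0 ≤ d a b)
    (Lℓ Ld : ℝ) (hLℓ : 0 < Lℓ) (hLd : 0 < Ld)
    (hlip : ∀ (a b : Fin k → ℝ) (y : Y), |ℓ a y - ℓ b y| ≤ Lℓ * ‖a - b‖)
    (hulip : ∀ (f g : X → Fin k → ℝ), Measurable f → Measurable g →
      ∀ (x : X) (e : E),
        |d (f x) (f (G x e)) - d (g x) (g (G x e))| ≤ Ld * ‖f x - g x‖)
    (γ : ℝ) (ε : ℝ) (hε : 0 < ε)
    (F : Set (X → Fin k → ℝ)) (hF : ∀ f ∈ F, Measurable f)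
    {H : Type*} (hH : Nonempty H)
    (φ : H → X → Fin k → ℝ) (hφF : ∀ θ, φ θ ∈ F)
    (hεparam : ∀ f ∈ F, ∃ θ : H, ∫ x, ‖φ θ x - f x‖ ∂(μ.map Prod.fst) ≤ ε)
    (hdiffint : ∀ f ∈ F, ∀ θ : H,
      Integrable (fun x => ‖φ θ x - f x‖) (μ.map Prod.fst))
    (hRint : ∀ f ∈ F, Integrable (fun p : X × Y => ℓ (f p.1) p.2) μ)
    (hLreg : ∀ f ∈ F, Measurable (fun e => mbdgLval G μ d f e) ∧
      ∀ lam : Measure E, IsFiniteMeasure lam →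
        Integrable (fun e => mbdgLval G μ d f e) lam)
    -- (i) strong duality for the relaxed problem, with dual optimum λ*
    (lamstar : Measure E) [IsFiniteMeasure lamstar]
    (hstrong : ∀ f ∈ F, mbdgPgamma G μ ℓ d F γ ≤ mbdgLag G μ ℓ d γ lamstar f)
    -- (ii) primal attainment
    (fstar : X → Fin k → ℝ) (hfstarF : fstar ∈ F)
    (hfstarfeas : ∀ e : E, mbdgLval G μ d fstar e ≤ γ)
    (hfstaropt : mbdgRisk μ ℓ fstar = mbdgPgamma G μ ℓ d F γ)
    -- (iii) dual optimality of λ*_pert for the perturbed problem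
    (lampert : Measure E) [IsFiniteMeasure lampert]
    (hpert : ∀ f ∈ F,
      mbdgPertDualValue G μ ℓ d γ F (max Lℓ Ld) ε
        ≤ ((mbdgLag G μ ℓ d γ lampert f
              + max Lℓ Ld * ε * (1 + (lampert Set.univ).toReal) : ℝ) : EReal)) :
    ((mbdgPgamma G μ ℓ d F γ : ℝ) : EReal) ≤ mbdgDualValue G μ ℓ d γ φ
    ∧ mbdgDualValue G μ ℓ d γ φ
        ≤ ((mbdgPgamma G μ ℓ d F γ
              + max Lℓ Ld * ε * (1 + (lampert Set.univ).toReal) : ℝ) : EReal)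
    ∧ |mbdgPgamma G μ ℓ d F γ - (mbdgDualValue G μ ℓ d γ φ).toReal|
        ≤ ε * (1 + (lampert Set.univ).toReal) * max Lℓ Ld := by
  have hc : ∀ f ∈ F, ∃ θ : H, ∀ lam : Measure E, IsFiniteMeasure lam →
      mbdgLag G μ ℓ d γ lam (φ θ)
        ≤ mbdgLag G μ ℓ d γ lam f + max Lℓ Ld * ε * (1 + (lam Set.univ).toReal) := by
    intro f hf
    obtain ⟨θ, hθ⟩ := hεparam f hf
    have hscale : ∀ L : ℝ, 0 < L → L ≤ max Lℓ Ld →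
        L * ∫ x, ‖φ θ x - f x‖ ∂(μ.map Prod.fst) ≤ max Lℓ Ld * ε := fun L hL hLc =>
      (mul_le_mul_of_nonneg_left hθ hL.le).trans (mul_le_mul_of_nonneg_right hLc hε.le)
    refine ⟨θ, fun lam hlam => mbdgLag_le_add ((hLreg _ (hφF θ)).2 lam hlam)
      ((hLreg f hf).2 lam hlam) ?_ fun e => ?_⟩
    · have h := abs_mbdgRisk_sub_le hlip (hRint _ (hφF θ)) (hRint f hf) (hdiffint f hf θ)
      linarith [le_of_abs_le h, hscale Lℓ hLℓ (le_max_left _ _)]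
    · have h := abs_mbdgLval_sub_le hdmeas (hG e) (hF _ (hφF θ)) (hF f hf)
        (fun x => hulip _ _ (hF _ (hφF θ)) (hF f hf) x e) (hdiffint f hf θ)
      linarith [le_of_abs_le h, hscale Ld hLd (le_max_right _ _)]
  have hlower : ((mbdgPgamma G μ ℓ d F γ : ℝ) : EReal) ≤ mbdgDualValue G μ ℓ d γ φ :=
    le_trans (le_iInf fun θ => EReal.coe_le_coe_iff.2 (hstrong _ (hφF θ)))
      (le_sSup ⟨lamstar, inferInstance, rfl⟩)
  have hdual : mbdgDualValue G μ ℓ d γ φ ≤ mbdgPertDualValue G μ ℓ d γ F (max Lℓ Ld) ε := by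
    refine sSup_le ?_
    rintro _ ⟨lam, hlam, rfl⟩
    refine le_trans ?_ (le_sSup ⟨lam, hlam, rfl⟩)
    rw [← EReal.sub_le_iff_le_add (Or.inl (EReal.coe_ne_bot _)) (Or.inl (EReal.coe_ne_top _))]
    refine le_iInf fun f => ?_
    rw [EReal.sub_le_iff_le_add (Or.inl (EReal.coe_ne_bot _)) (Or.inl (EReal.coe_ne_top _)),
      ← EReal.coe_add]
    obtain ⟨θ, hθ⟩ := hc f.1 f.2
    exact (iInf_le _ θ).trans (EReal.coe_le_coe_iff.2 (hθ lam hlam))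
  have hupper : mbdgDualValue G μ ℓ d γ φ
      ≤ ((mbdgPgamma G μ ℓ d F γ
            + max Lℓ Ld * ε * (1 + (lampert Set.univ).toReal) : ℝ) : EReal) := by
    refine (hdual.trans (hpert fstar hfstarF)).trans (EReal.coe_le_coe_iff.2 ?_)
    have h : mbdgLag G μ ℓ d γ lampert fstar ≤ mbdgRisk μ ℓ fstar :=
      mbdgLag_le_mbdgRisk lampert hfstarfeas
    linarith
  refine ⟨hlower, hupper, ?_⟩
  have hbot := ne_bot_of_le_ne_bot (EReal.coe_ne_bot _) hlower
  have htop := ne_top_of_le_ne_top (EReal.coe_ne_top _) hupper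
  rw [← EReal.coe_toReal htop hbot, EReal.coe_le_coe_iff] at hlower hupper
  rw [abs_sub_comm, abs_of_nonneg (sub_nonneg.2 hlower)]
  linarith

end
end
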